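/- arXiv:1811.11463 — 2 statements merged into one kernel-verified Lean document; each statement's English description precedes it below -/
import Mathlib

section
/- With the setup of the preceding construction (n ≥ 2, δ₁ = ε³, δ₂ = ε^{3/2}, ω = ε^{−3}, ρ = ε, and f : {x₁ ≥ 0} → ℝ the corresponding deformation function, supported in Ω ∪ D where D = {x ∉ Ω : d(x, Ω) ≤ ρ}), the area of the graph of f converges to the Lebesgue measure of its base: lim_{ε→0} [ ∫_{Ω ∪ D} √(1 + ‖∇f(x)‖²) dx − Vol(Ω ∪ D) ] = 0. -/
open MeasureTheory Filter

lemma saw_val (F : ℝ → ℝ)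
    (hF1 : ∀ t ∈ Set.Icc (0 : ℝ) 2, F t = 1 - t)
    (hF2 : ∀ t ∈ Set.Icc (2 : ℝ) 4, F t = t - 3) (t : ℝ) (h0 : 0 ≤ t) (h4 : t ≤ 4) :
    F t = |t - 2| - 1 := by
  rcases le_total t 2 with h | h
  · rw [hF1 t ⟨h0, h⟩, abs_of_nonpos (by linarith)]; ring
  · rw [hF2 t ⟨h, h4⟩, abs_of_nonneg (by linarith)]; ring

lemma saw_bdd (F : ℝ → ℝ) (hFper : ∀ t, F (t + 4) = F t)
    (hF1 : ∀ t ∈ Set.Icc (0 : ℝ) 2, F t = 1 - t)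
    (hF2 : ∀ t ∈ Set.Icc (2 : ℝ) 4, F t = t - 3) (t : ℝ) : |F t| ≤ 1 := by
  have hp : Function.Periodic F 4 := hFper
  obtain ⟨y, hy, he⟩ := hp.exists_mem_Ico₀ (by norm_num) t
  rw [he, saw_val F hF1 hF2 y hy.1 hy.2.le, abs_le]
  have := abs_nonneg (y - 2)
  have h2 : |y - 2| ≤ 2 := abs_le.2 ⟨by linarith [hy.1], by linarith [hy.2]⟩
  constructor <;> linarith

lemma saw_lip_aux (F : ℝ → ℝ) (hFper : ∀ t, F (t + 4) = F t)
    (hF1 : ∀ t ∈ Set.Icc (0 : ℝ) 2, F t = 1 - t)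
    (hF2 : ∀ t ∈ Set.Icc (2 : ℝ) 4, F t = t - 3) (s t : ℝ) (hst : s ≤ t) :
    |F s - F t| ≤ t - s := by
  by_cases hbig : 2 ≤ t - s
  · have h1 := abs_le.1 (saw_bdd F hFper hF1 hF2 s)
    have h2 := abs_le.1 (saw_bdd F hFper hF1 hF2 t)
    rw [abs_le]; constructor <;> linarith
  push Not at hbig
  have hp : Function.Periodic F 4 := hFper
  set k := toIcoDiv (by norm_num : (0:ℝ) < 4) 0 s with hk
  have hm := sub_toIcoDiv_zsmul_mem_Ico (by norm_num : (0:ℝ) < 4) 0 s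
  rw [← hk] at hm
  have e1 : F (s - k • (4:ℝ)) = F s := hp.sub_zsmul_eq k
  have e2 : F (t - k • (4:ℝ)) = F t := hp.sub_zsmul_eq k
  set c := k • (4:ℝ) with hc
  obtain ⟨a1, a2⟩ := hm
  rw [← e1, ← e2, saw_val F hF1 hF2 _ a1 (by linarith)]
  by_cases h4 : t - c ≤ 4
  · rw [saw_val F hF1 hF2 _ (by linarith) h4]
    have := abs_abs_sub_abs_le (s - c - 2) (t - c - 2)
    have e : |s - c - 2 - (t - c - 2)| = t - s := by
      rw [abs_of_nonpos (by linarith)]; ring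
    rw [e] at this
    rw [sub_sub_sub_cancel_right]
    exact this
  · push Not at h4
    have e3 : F (t - c) = 5 - (t - c) := by
      rw [show t - c = (t - c - 4) + 4 by ring, hFper,
        hF1 _ ⟨by linarith, by linarith⟩]; ring
    rw [e3, abs_of_nonneg (by linarith : 0 ≤ s - c - 2), abs_le]
    constructor <;> linarith

lemma saw_lip (F : ℝ → ℝ) (hFper : ∀ t, F (t + 4) = F t)
    (hF1 : ∀ t ∈ Set.Icc (0 : ℝ) 2, F t = 1 - t)
    (hF2 : ∀ t ∈ Set.Icc (2 : ℝ) 4, F t = t - 3) (s t : ℝ) :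
    |F s - F t| ≤ |s - t| := by
  rcases le_total s t with h | h
  · have := saw_lip_aux F hFper hF1 hF2 s t h
    rw [abs_of_nonpos (by linarith : s - t ≤ 0)]; linarith
  · have := saw_lip_aux F hFper hF1 hF2 t s h
    rw [abs_of_nonneg (by linarith : 0 ≤ s - t), abs_sub_comm]; linarith

lemma prod3 (a b c a' b' c' P Q R β d : ℝ) (ha' : |a'| ≤ 1) (hb : |b| ≤ β) (hb' : |b'| ≤ β)
    (hc : |c| ≤ 1) (hβ : 0 ≤ β) (hd : 0 ≤ d) (hP : 0 ≤ P) (hQ : 0 ≤ Q) (hR : 0 ≤ R)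
    (h1 : |a - a'| ≤ P * d) (h2 : |b - b'| ≤ Q * d) (h3 : |c - c'| ≤ R * d) :
    |a * (b * c) - a' * (b' * c')| ≤ (P * β + Q + β * R) * d := by
  have e : a * (b * c) - a' * (b' * c')
      = (a - a') * (b * c) + a' * ((b - b') * c) + a' * (b' * (c - c')) := by ring
  rw [e]
  refine (abs_add_three _ _ _).trans ?_
  simp only [abs_mul]
  have i1 : |a - a'| * (|b| * |c|) ≤ (P * d) * (β * 1) := by gcongr
  have i2 : |a'| * (|b - b'| * |c|) ≤ 1 * ((Q * d) * 1) := by gcongr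
  have i3 : |a'| * (|b'| * |c - c'|) ≤ 1 * (β * (R * d)) := by gcongr
  linarith

lemma norm_pr (m : ℕ) (x : EuclideanSpace ℝ (Fin (m + 1))) :
    ‖(WithLp.equiv 2 (Fin m → ℝ)).symm (fun i => x ⟨i.1 + 1, by have := i.2; omega⟩)‖
      = ‖x - EuclideanSpace.single (0 : Fin (m + 1)) (x 0)‖ := by
  rw [EuclideanSpace.norm_eq, EuclideanSpace.norm_eq, Fin.sum_univ_succ]
  congr 1
  simp
  rfl

lemma f_lip (n : ℕ) (z : Fin n) (F : ℝ → ℝ) (hb : ∀ t, |F t| ≤ 1)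
    (hl : ∀ s t, |F s - F t| ≤ |s - t|) (Ω : Set (EuclideanSpace ℝ (Fin n)))
    (pn : EuclideanSpace ℝ (Fin n) → ℝ)
    (hpn : ∀ x, pn x = ‖x - EuclideanSpace.single z (x z)‖)
    (δ₁ δ₂ ω ρ : ℝ) (h2 : 0 ≤ δ₂) (hω : 0 ≤ ω) (hρ : 0 < ρ) (K : NNReal)
    (hK : (K : ℝ) = ρ⁻¹ * δ₂ + 1 + δ₂ * (2 * ω)) :
    LipschitzWith K (fun x : EuclideanSpace ℝ (Fin n) =>
      if x z ≤ δ₁ + δ₂ then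
          max 0 (1 - Metric.infDist x Ω / ρ) *
            (max 0 (x z - δ₁) * F (ω * pn x))
        else
          max 0 (1 - Metric.infDist x Ω / ρ) *
            (δ₂ * F (ω * ‖x - EuclideanSpace.single z (δ₁ + δ₂)‖))) := by
  have key : (fun x : EuclideanSpace ℝ (Fin n) =>
      if x z ≤ δ₁ + δ₂ then
          max 0 (1 - Metric.infDist x Ω / ρ) *
            (max 0 (x z - δ₁) * F (ω * pn x))
        else
          max 0 (1 - Metric.infDist x Ω / ρ) *
            (δ₂ * F (ω * ‖x - EuclideanSpace.single z (δ₁ + δ₂)‖)))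
      = fun x => max 0 (1 - Metric.infDist x Ω / ρ) *
            (max 0 (min (x z) (δ₁ + δ₂) - δ₁) *
              F (ω * ‖x - EuclideanSpace.single z (min (x z) (δ₁ + δ₂))‖)) := by
    funext x
    split_ifs with h
    · rw [min_eq_left h, hpn]
    · push Not at h
      rw [min_eq_right h.le]
      congr 2
      rw [add_sub_cancel_left, max_eq_right h2]
  rw [key]
  refine LipschitzWith.of_dist_le_mul fun x y => ?_
  rw [Real.dist_eq, hK]
  have hz : |x z - y z| ≤ dist x y := by
    rw [dist_eq_norm]
    exact PiLp.norm_apply_le (x - y) z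
  have hmin : |min (x z) (δ₁ + δ₂) - min (y z) (δ₁ + δ₂)| ≤ dist x y :=
    (abs_min_sub_min_le_max _ _ _ _).trans (by simpa using hz)
  have hγ : ∀ t : ℝ, |max 0 (min t (δ₁ + δ₂) - δ₁)| ≤ δ₂ := by
    intro t
    rw [abs_of_nonneg (le_max_left _ _)]
    exact max_le h2 (by linarith [min_le_right t (δ₁ + δ₂)])
  refine prod3 _ _ _ _ _ _ ρ⁻¹ 1 (2 * ω) δ₂ (dist x y) ?_ (hγ _) (hγ _) (hb _) h2 dist_nonneg
    (by positivity) zero_le_one (by positivity) ?_ ?_ ?_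
  · rw [abs_of_nonneg (le_max_left _ _)]
    refine max_le zero_le_one ?_
    have : 0 ≤ Metric.infDist y Ω / ρ := div_nonneg Metric.infDist_nonneg hρ.le
    linarith
  · refine (abs_max_sub_max_le_max _ _ _ _).trans ?_
    have h := (Metric.lipschitz_infDist_pt Ω).dist_le_mul x y
    rw [Real.dist_eq, NNReal.coe_one, one_mul] at h
    refine max_le (by rw [sub_self, abs_zero]; positivity) ?_
    rw [show 1 - Metric.infDist x Ω / ρ - (1 - Metric.infDist y Ω / ρ)
      = ρ⁻¹ * -(Metric.infDist x Ω - Metric.infDist y Ω) by ring, abs_mul, abs_neg,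
      abs_of_nonneg (inv_nonneg.2 hρ.le)]
    gcongr
  · refine (abs_max_sub_max_le_max _ _ _ _).trans ?_
    refine max_le (by rw [sub_self, abs_zero]; positivity) ?_
    rw [sub_sub_sub_cancel_right, one_mul]
    exact hmin
  · refine (hl _ _).trans ?_
    rw [← mul_sub, abs_mul, abs_of_nonneg hω, mul_comm 2 ω, mul_assoc]
    gcongr
    refine (abs_norm_sub_norm_le _ _).trans ?_
    rw [sub_sub_sub_comm]
    refine (norm_sub_le _ _).trans ?_
    have : EuclideanSpace.single z (min (x z) (δ₁ + δ₂))
        - EuclideanSpace.single z (min (y z) (δ₁ + δ₂))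
        = (EuclideanSpace.single z (min (x z) (δ₁ + δ₂) - min (y z) (δ₁ + δ₂)) :
          EuclideanSpace ℝ (Fin n)) := by
      ext i
      by_cases h : i = z <;> simp [h]
    rw [this, EuclideanSpace.norm_single, Real.norm_eq_abs, ← dist_eq_norm]
    linarith

lemma int_bound (n : ℕ) (S : Set (EuclideanSpace ℝ (Fin n))) (R : ℝ) (hR : 0 ≤ R)
    (hS : S ⊆ Metric.closedBall 0 R) (f : EuclideanSpace ℝ (Fin n) → ℝ) (K : NNReal)
    (hf : LipschitzWith K f) :
    |(∫ x in S, Real.sqrt (1 + ‖gradient f x‖ ^ 2)) - (volume S).toReal|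
      ≤ (2 + K) * (R ^ n *
        (volume (Metric.ball (0 : EuclideanSpace ℝ (Fin n)) 1)).toReal) := by
  have hfin : volume S < ⊤ :=
    (measure_mono hS).trans_lt (isCompact_closedBall _ _).measure_lt_top
  have hvol : (volume S).toReal ≤ R ^ n *
        (volume (Metric.ball (0 : EuclideanSpace ℝ (Fin n)) 1)).toReal := by
    have h := ENNReal.toReal_mono (isCompact_closedBall _ _).measure_lt_top.ne
      (measure_mono (μ := volume) hS)
    rw [Measure.addHaar_closedBall _ _ hR, ENNReal.toReal_mul,
      ENNReal.toReal_ofReal (by positivity), finrank_euclideanSpace_fin] at h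
    exact h
  have hg : ∀ x, ‖gradient f x‖ ≤ K := by
    intro x
    unfold gradient
    rw [LinearIsometryEquiv.norm_map]
    exact norm_fderiv_le_of_lipschitz ℝ hf
  have hi := norm_setIntegral_le_of_norm_le_const (μ := volume) (s := S)
    (f := fun x => Real.sqrt (1 + ‖gradient f x‖ ^ 2)) (C := 1 + K) hfin (by
      intro x _
      rw [Real.norm_eq_abs, abs_of_nonneg (Real.sqrt_nonneg _)]
      apply Real.sqrt_le_iff.2 ⟨by positivity, ?_⟩
      have := hg x
      have h0 := norm_nonneg (gradient f x)
      have h1 : (0:ℝ) ≤ K := K.2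
      nlinarith)
  rw [Real.norm_eq_abs] at hi
  refine (abs_sub _ _).trans ?_
  have h0 : 0 ≤ (volume S).toReal := ENNReal.toReal_nonneg
  rw [abs_of_nonneg h0]
  calc _ ≤ (1 + K) * (volume S).toReal + (volume S).toReal := by gcongr; exact hi
    _ = (2 + K) * (volume S).toReal := by ring
    _ ≤ _ := by gcongr

/-- With the parameters `δ₁ = ε³`, `δ₂ = ε^{3/2}`, `ω = ε⁻³`, `ρ = ε` and
the deformation function `f` supported in `Ω ∪ D`, the area of the graph of `f` over
`Ω ∪ D` converges to the Lebesgue measure of `Ω ∪ D` as `ε → 0⁺`: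
`∫_{Ω∪D} √(1 + ‖∇f‖²) dx − Vol(Ω ∪ D) → 0`. -/
theorem stmt_9 (n : ℕ) (hn : 2 ≤ n)
    (F : ℝ → ℝ) (hFper : ∀ t, F (t + 4) = F t)
    (hF1 : ∀ t ∈ Set.Icc (0 : ℝ) 2, F t = 1 - t)
    (hF2 : ∀ t ∈ Set.Icc (2 : ℝ) 4, F t = t - 3) :
    Tendsto (fun ε : ℝ =>
      let δ₁ : ℝ := ε ^ 3
      let δ₂ : ℝ := ε ^ ((3 : ℝ) / 2)
      let ω : ℝ := (ε ^ 3)⁻¹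
      let ρ : ℝ := ε
      let δ : ℝ := δ₁ + δ₂
      let q : EuclideanSpace ℝ (Fin n) := EuclideanSpace.single (⟨0, by omega⟩ : Fin n) δ
      let pr : EuclideanSpace ℝ (Fin n) → EuclideanSpace ℝ (Fin (n - 1)) :=
        fun x => (WithLp.equiv 2 (Fin (n - 1) → ℝ)).symm
          (fun i => x ⟨i.1 + 1, by have := i.2; omega⟩)
      let A := {x : EuclideanSpace ℝ (Fin n) | δ ≤ x ⟨0, by omega⟩ ∧ ‖x - q‖ ≤ ε}
      let B := {x : EuclideanSpace ℝ (Fin n) |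
        δ₁ ≤ x ⟨0, by omega⟩ ∧ x ⟨0, by omega⟩ ≤ δ ∧ ‖pr x‖ ≤ ε}
      let C := {x : EuclideanSpace ℝ (Fin n) |
        0 ≤ x ⟨0, by omega⟩ ∧ x ⟨0, by omega⟩ ≤ δ₁ ∧ ‖pr x‖ ≤ ε}
      let Ω := A ∪ B ∪ C
      let D := {x : EuclideanSpace ℝ (Fin n) |
        x ∉ Ω ∧ 0 ≤ x ⟨0, by omega⟩ ∧ Metric.infDist x Ω ≤ ρ}
      let f : EuclideanSpace ℝ (Fin n) → ℝ := fun x =>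
        if x ⟨0, by omega⟩ ≤ δ then
          max 0 (1 - Metric.infDist x Ω / ρ) *
            (max 0 (x ⟨0, by omega⟩ - δ₁) * F (ω * ‖pr x‖))
        else
          max 0 (1 - Metric.infDist x Ω / ρ) * (δ₂ * F (ω * ‖x - q‖))
      (∫ x in Ω ∪ D, Real.sqrt (1 + ‖gradient f x‖ ^ 2)) - (volume (Ω ∪ D)).toReal)
      (nhdsWithin 0 (Set.Ioi 0)) (nhds 0) := by
  obtain ⟨m, rfl⟩ : ∃ m, n = m + 1 := ⟨n - 1, by omega⟩
  set v := (volume (Metric.ball (0 : EuclideanSpace ℝ (Fin (m + 1))) 1)).toReal with hv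
  have hv0 : 0 ≤ v := ENNReal.toReal_nonneg
  have hlim : Tendsto (fun ε : ℝ => 6 * 5 ^ (m + 1) * v * Real.sqrt ε)
      (nhdsWithin 0 (Set.Ioi 0)) (nhds 0) := by
    have h : Continuous (fun ε : ℝ => 6 * 5 ^ (m + 1) * v * Real.sqrt ε) := by fun_prop
    have h' := h.tendsto 0
    simp only [Real.sqrt_zero, mul_zero] at h'
    exact h'.mono_left nhdsWithin_le_nhds
  refine squeeze_zero_norm' ?_ hlim
  filter_upwards [Ioo_mem_nhdsGT (zero_lt_one (α := ℝ))] with ε hε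
  obtain ⟨hε0, hε1⟩ := hε
  extract_lets δ₁ δ₂ ω ρ δ q pr A B C Ω D f
  set s := Real.sqrt ε with hs
  have hs0 : 0 < s := Real.sqrt_pos.2 hε0
  have hss : ε = s ^ 2 := (Real.sq_sqrt hε0.le).symm
  have hs1 : s ≤ 1 := by
    rw [hs]; exact Real.sqrt_le_one.2 hε1.le
  have hδ₂ : δ₂ = s ^ 3 := by
    change ε ^ ((3 : ℝ) / 2) = s ^ 3
    rw [hs, Real.sqrt_eq_rpow, ← Real.rpow_natCast, ← Real.rpow_mul hε0.le]
    norm_num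
  have hδ₁ : δ₁ = s ^ 6 := by
    change ε ^ 3 = s ^ 6
    rw [hss]; ring
  have hω : ω = (s ^ 6)⁻¹ := by rw [← hδ₁]
  have hδ0 : 0 ≤ δ := by
    change 0 ≤ δ₁ + δ₂
    rw [hδ₁, hδ₂]; positivity
  have hδ : δ ≤ 2 * ε := by
    change δ₁ + δ₂ ≤ 2 * ε
    rw [hδ₁, hδ₂, hss]
    have h1 : s ^ 6 ≤ s ^ 2 := pow_le_pow_of_le_one hs0.le hs1 (by norm_num)
    have h2 : s ^ 3 ≤ s ^ 2 := pow_le_pow_of_le_one hs0.le hs1 (by norm_num)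
    linarith
  have hδ₁δ : δ₁ ≤ δ := by
    change δ₁ ≤ δ₁ + δ₂
    rw [hδ₂]
    have : 0 ≤ s ^ 3 := by positivity
    linarith
  have hpr : ∀ x, ‖pr x‖ = ‖x - EuclideanSpace.single (0 : Fin (m + 1)) (x 0)‖ := norm_pr m
  have hprb : ∀ x : EuclideanSpace ℝ (Fin (m + 1)), 0 ≤ x 0 → x 0 ≤ δ → ‖pr x‖ ≤ ε →
      ‖x‖ ≤ 3 * ε := by
    intro x h0 h1 h2
    rw [hpr] at h2
    have h3 := norm_le_norm_sub_add x (EuclideanSpace.single (0 : Fin (m + 1)) (x 0))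
    rw [EuclideanSpace.norm_single, Real.norm_eq_abs, abs_of_nonneg h0] at h3
    linarith
  have hΩ : ∀ x ∈ Ω, ‖x‖ ≤ 3 * ε := by
    rintro x ((hx | hx) | hx)
    · have h3 := norm_le_norm_sub_add x q
      have hq : ‖q‖ = δ := by
        change ‖EuclideanSpace.single (0 : Fin (m + 1)) δ‖ = δ
        rw [EuclideanSpace.norm_single, Real.norm_eq_abs, abs_of_nonneg hδ0]
      have := hx.2
      linarith
    · exact hprb x (le_trans (by rw [hδ₁]; positivity) hx.1) hx.2.1 hx.2.2
    · exact hprb x hx.1 (hx.2.1.trans hδ₁δ) hx.2.2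
  have hne : Ω.Nonempty := by
    refine ⟨0, Or.inr ⟨le_rfl, ?_, ?_⟩⟩
    · change (0:ℝ) ≤ δ₁
      rw [hδ₁]; positivity
    · rw [hpr]; simp [hε0.le]
  have hS : Ω ∪ D ⊆ Metric.closedBall 0 (5 * ε) := by
    rintro x (hx | hx)
    · rw [mem_closedBall_zero_iff]
      linarith [hΩ x hx]
    · rw [mem_closedBall_zero_iff]
      have h : Metric.infDist x Ω < 2 * ε := lt_of_le_of_lt hx.2.2 (by change ε < 2 * ε; linarith)
      obtain ⟨y, hy, hxy⟩ := (Metric.infDist_lt_iff hne).1 h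
      rw [dist_eq_norm] at hxy
      have := norm_le_norm_sub_add x y
      linarith [hΩ y hy]
  have hK0 : 0 ≤ ρ⁻¹ * δ₂ + 1 + δ₂ * (2 * ω) := by
    rw [hδ₂, hω]
    have : 0 < ρ := hε0
    positivity
  have hlip : LipschitzWith (NNReal.mk _ hK0) f :=
    f_lip (m + 1) 0 F (saw_bdd F hFper hF1 hF2) (saw_lip F hFper hF1 hF2) Ω (fun x => ‖pr x‖) hpr
      δ₁ δ₂ ω ρ (by rw [hδ₂]; positivity) (by rw [hω]; positivity) hε0 (NNReal.mk _ hK0) rfl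
  have hfin := int_bound (m + 1) (Ω ∪ D) (5 * ε) (by positivity) hS f _ hlip
  rw [Real.norm_eq_abs]
  refine hfin.trans ?_
  rw [← hv, NNReal.coe_mk, mul_pow]
  have hρ : ρ = s ^ 2 := hss
  have hεp : ε ^ (m + 1) ≤ s ^ 4 := by
    rw [hss, ← pow_mul]
    exact pow_le_pow_of_le_one hs0.le hs1 (by omega)
  have hcoef : (2 + (ρ⁻¹ * δ₂ + 1 + δ₂ * (2 * ω))) * s ^ 4 ≤ 6 * s := by
    rw [hρ, hδ₂, hω]
    have e : (2 + ((s ^ 2)⁻¹ * s ^ 3 + 1 + s ^ 3 * (2 * (s ^ 6)⁻¹))) * s ^ 4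
        = 3 * s ^ 4 + s ^ 5 + 2 * s := by
      field_simp
      ring
    rw [e]
    have h1 : s ^ 4 ≤ s := pow_le_of_le_one hs0.le hs1 (by norm_num)
    have h2 : s ^ 5 ≤ s := pow_le_of_le_one hs0.le hs1 (by norm_num)
    linarith
  calc _ ≤ (2 + (ρ⁻¹ * δ₂ + 1 + δ₂ * (2 * ω))) * (5 ^ (m + 1) * s ^ 4 * v) := by gcongr
    _ = ((2 + (ρ⁻¹ * δ₂ + 1 + δ₂ * (2 * ω))) * s ^ 4) * (5 ^ (m + 1) * v) := by ring
    _ ≤ (6 * s) * (5 ^ (m + 1) * v) := by gcongr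
    _ = _ := by ring
end

section
/- With the setup of the preceding construction (n ≥ 2, δ₁ = ε³, δ₂ = ε^{3/2}, ω = ε^{−3}, ρ = ε, and f the corresponding deformation function supported in Ω ∪ D), there exist constants K > 0 and ε₀ > 0 such that for all 0 < ε < ε₀ and every x ∈ Ω ∪ D there is a rectifiable path contained in the graph S_f = {(y, f(y)) : y₁ ≥ 0} ⊆ ℝ^{n+1} from the point (x, f(x)) to some point (z, 0) with z₁ = 0, whose length is at most K ε. -/
open MeasureTheory

/-- Embedding of `ℝⁿ × ℝ` into `ℝ^{n+1}`, sending `(a, t)` to `(a₁, …, aₙ, t)`. -/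
noncomputable def emb (n : ℕ) (a : EuclideanSpace ℝ (Fin n)) (t : ℝ) :
    EuclideanSpace ℝ (Fin (n + 1)) :=
  (WithLp.equiv 2 (Fin (n + 1) → ℝ)).symm
    (Fin.snoc (WithLp.equiv 2 (Fin n → ℝ) a) t)

def LPath {V : Type*} [NormedAddCommGroup V] (S : Set V) (a b : V) (L : ℝ) : Prop :=
  ∃ g : ℝ → V, g 0 = a ∧ g 1 = b ∧ (∀ t ∈ Set.Icc (0 : ℝ) 1, g t ∈ S) ∧
    ∀ s ∈ Set.Icc (0 : ℝ) 1, ∀ t ∈ Set.Icc (0 : ℝ) 1, ‖g s - g t‖ ≤ L * |s - t|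

lemma LPath.mono {V : Type*} [NormedAddCommGroup V] {S : Set V} {a b : V} {L M : ℝ}
    (h : LPath S a b L) (hLM : L ≤ M) : LPath S a b M := by
  obtain ⟨g, h0, h1, h2, h3⟩ := h
  exact ⟨g, h0, h1, h2, fun s hs t ht => (h3 s hs t ht).trans (by gcongr)⟩

lemma LPath.trans {V : Type*} [NormedAddCommGroup V] {S : Set V} {a b c : V} {L : ℝ}
    (hL : 0 ≤ L) (h : LPath S a b L) (h' : LPath S b c L) : LPath S a c (4 * L) := by
  obtain ⟨g, h0, h1, h2, h3⟩ := h
  obtain ⟨g', h0', h1', h2', h3'⟩ := h'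
  have m1 : ∀ t ∈ Set.Icc (0 : ℝ) 1, min (2 * t) 1 ∈ Set.Icc (0 : ℝ) 1 := fun t ht =>
    ⟨le_min (by linarith [ht.1]) zero_le_one, min_le_right _ _⟩
  have m2 : ∀ t ∈ Set.Icc (0 : ℝ) 1, max (2 * t - 1) 0 ∈ Set.Icc (0 : ℝ) 1 := fun t ht =>
    ⟨le_max_right _ _, max_le (by linarith [ht.2]) zero_le_one⟩
  refine ⟨fun t => g (min (2 * t) 1) + g' (max (2 * t - 1) 0) - b, ?_, ?_, ?_, ?_⟩
  · simp [h0, h0']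
  · norm_num [h1, h1']
  · intro t ht
    rcases le_total (2 * t) 1 with h | h
    · have := h2 _ (m1 t ht)
      simpa [max_eq_right (sub_nonpos.2 h), h0'] using this
    · have := h2' _ (m2 t ht)
      simpa [min_eq_right h, h1] using this
  · intro s hs t ht
    have e1 := h3 _ (m1 s hs) _ (m1 t ht)
    have e2 := h3' _ (m2 s hs) _ (m2 t ht)
    have a1 : |min (2 * s) 1 - min (2 * t) 1| ≤ 2 * |s - t| := by
      have := abs_min_sub_min_le_max (2 * s) 1 (2 * t) 1
      rwa [sub_self, abs_zero, max_eq_left (abs_nonneg (2 * s - 2 * t)), ← mul_sub, abs_mul,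
        abs_two] at this
    have a2 : |max (2 * s - 1) 0 - max (2 * t - 1) 0| ≤ 2 * |s - t| := by
      have := abs_max_sub_max_le_abs (2 * s - 1) (2 * t - 1) 0
      rwa [sub_sub_sub_cancel_right, ← mul_sub, abs_mul, abs_two] at this
    have a1' := mul_le_mul_of_nonneg_left a1 hL
    have a2' := mul_le_mul_of_nonneg_left a2 hL
    have : g (min (2 * s) 1) + g' (max (2 * s - 1) 0) - b
        - (g (min (2 * t) 1) + g' (max (2 * t - 1) 0) - b)
        = (g (min (2 * s) 1) - g (min (2 * t) 1))
          + (g' (max (2 * s - 1) 0) - g' (max (2 * t - 1) 0)) := by abel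
    simp only [this]
    refine (norm_add_le _ _).trans ?_
    linarith

lemma LPath.fin {V : Type*} [NormedAddCommGroup V] {S : Set V} {a b : V} {L : ℝ}
    (hL : 0 ≤ L) (h : LPath S a b L) : ∃ g : ℝ → V, ContinuousOn g (Set.Icc 0 1) ∧
      g 0 = a ∧ g 1 = b ∧ (∀ t ∈ Set.Icc (0 : ℝ) 1, g t ∈ S) ∧
      eVariationOn g (Set.Icc 0 1) ≤ ENNReal.ofReal L := by
  obtain ⟨g, h0, h1, h2, h3⟩ := h
  have hl : LipschitzOnWith (Real.toNNReal L) g (Set.Icc 0 1) := by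
    apply LipschitzOnWith.of_dist_le_mul
    intro s hs t ht
    rw [dist_eq_norm, Real.dist_eq, Real.coe_toNNReal _ hL]
    exact h3 s hs t ht
  refine ⟨g, hl.continuousOn, h0, h1, h2, ?_⟩
  have e1 := hl.comp_eVariationOn_le (g := (id : ℝ → ℝ)) (s := Set.Icc 0 1) (fun _ h => h)
  have e2 := (monotone_id.monotoneOn (Set.Icc (0:ℝ) 1)).eVariationOn_le
    (Set.left_mem_Icc.2 zero_le_one) (Set.right_mem_Icc.2 zero_le_one)
  simp only [Set.inter_self, id, sub_zero, ENNReal.ofReal_one] at e2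
  refine e1.trans ?_
  calc _ ≤ (Real.toNNReal L : ENNReal) * 1 := by gcongr
    _ = _ := by simp [ENNReal.ofReal]

lemma emb_sub_norm (n : ℕ) (a b : EuclideanSpace ℝ (Fin n)) (s t : ℝ) :
    ‖emb n a s - emb n b t‖ ≤ ‖a - b‖ + |s - t| := by
  have h : ‖emb n a s - emb n b t‖ ^ 2 = ‖a - b‖ ^ 2 + |s - t| ^ 2 := by
    rw [EuclideanSpace.norm_sq_eq, EuclideanSpace.norm_sq_eq, Fin.sum_univ_castSucc]
    simp [emb]
  refine abs_le_of_sq_le_sq' (a := ‖emb n a s - emb n b t‖) ?_ (by positivity) |>.2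
  rw [h]
  nlinarith [norm_nonneg (a - b), abs_nonneg (s - t), mul_nonneg (norm_nonneg (a - b)) (abs_nonneg (s - t))]

/-- Product estimate. -/
lemma prod_est {ε s r d d' b b' c M N : ℝ} (hε : 0 < ε) (hs : 0 ≤ s) (hd' : 0 ≤ d')
    (hd : |d - d'| ≤ M * r) (hb : |b| ≤ s) (hbb : |b - b'| ≤ N * r) (hc : |c| ≤ 1) (hsε : s ≤ ε)
    (hMr : 0 ≤ M * r) :
    |max 0 (1 - d / ε) * (b * c) - max 0 (1 - d' / ε) * (b' * c)| ≤ (M + N) * r := by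
  set e := max 0 (1 - d / ε)
  set e' := max 0 (1 - d' / ε)
  have he' : |e'| ≤ 1 := by
    rw [abs_of_nonneg (le_max_left _ _)]
    exact max_le zero_le_one (by have := div_nonneg hd' hε.le; linarith)
  have hee : |e - e'| ≤ M * r / ε := by
    have := abs_max_sub_max_le_abs (1 - d / ε) (1 - d' / ε) 0
    rw [max_comm _ 0, max_comm _ 0] at this
    refine this.trans ?_
    have h2 : 1 - d / ε - (1 - d' / ε) = -((d - d') / ε) := by ring
    rw [h2, abs_neg, abs_div, abs_of_pos hε]
    gcongr
  have h3 : e * (b * c) - e' * (b' * c) = ((e - e') * b + e' * (b - b')) * c := by ring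
  rw [h3, abs_mul]
  have h4 : |(e - e') * b + e' * (b - b')| ≤ M * r + N * r := by
    refine (abs_add_le _ _).trans ?_
    rw [abs_mul, abs_mul]
    have h5 : |e - e'| * |b| ≤ M * r := by
      calc _ ≤ M * r / ε * ε := by gcongr; exact hb.trans hsε
        _ = _ := by field_simp
    have h6 : |e'| * |b - b'| ≤ 1 * (N * r) := by gcongr
    linarith
  calc _ ≤ (M * r + N * r) * 1 := by gcongr; exact (abs_nonneg _).trans h4
    _ = _ := by ring

lemma core {n : ℕ} {i0 i1 : Fin n} (hi : i1 ≠ i0) {ε s δ₁ : ℝ} (hε : 0 < ε)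
    (hs : 0 < s) (hsε : s ≤ ε) (hδ : 0 < δ₁) (hδε : δ₁ ≤ ε)
    {q : EuclideanSpace ℝ (Fin n)} (hq : q = EuclideanSpace.single i0 (δ₁ + s))
    {d G f : EuclideanSpace ℝ (Fin n) → ℝ} {H : ℝ → ℝ}
    (hd0 : ∀ x, 0 ≤ d x) (hd : ∀ x y, |d x - d y| ≤ ‖x - y‖)
    (hG : ∀ x, |G x| ≤ 1) (hGi : ∀ x c, G (x + EuclideanSpace.single i0 c) = G x)
    (hH : ∀ t, |H t| ≤ 1)
    (hf1 : ∀ x : EuclideanSpace ℝ (Fin n), 0 ≤ x i0 → x i0 ≤ δ₁ + s →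
      f x = max 0 (1 - d x / ε) * (max 0 (x i0 - δ₁) * G x))
    (hf2 : ∀ x : EuclideanSpace ℝ (Fin n), δ₁ + s ≤ x i0 →
      f x = max 0 (1 - d x / ε) * (s * H ‖x - q‖))
    (x : EuclideanSpace ℝ (Fin n)) (hx : 0 ≤ x i0) (hxq : ‖x - q‖ ≤ 5 * ε) :
    ∃ z : EuclideanSpace ℝ (Fin n), z i0 = 0 ∧
      LPath {p | ∃ y : EuclideanSpace ℝ (Fin n), 0 ≤ y i0 ∧ p = emb n y (f y)}
        (emb n x (f x)) (emb n z 0) (160 * ε) := by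
  have key1 : ∀ x : EuclideanSpace ℝ (Fin n), 0 ≤ x i0 → x i0 ≤ δ₁ + s →
      ∃ z : EuclideanSpace ℝ (Fin n), z i0 = 0 ∧
      LPath {p | ∃ y : EuclideanSpace ℝ (Fin n), 0 ≤ y i0 ∧ p = emb n y (f y)}
        (emb n x (f x)) (emb n z 0) (40 * ε) := by
    clear hx hxq x
    intro x hx0 hx1
    let p : ℝ → EuclideanSpace ℝ (Fin n) := fun t => x + EuclideanSpace.single i0 (-(t * x i0))
    have hp0 : ∀ t, p t i0 = (1 - t) * x i0 := by
      intro t; simp [p]; ring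
    have hpn : ∀ t ∈ Set.Icc (0:ℝ) 1, 0 ≤ p t i0 := by
      intro t ht; rw [hp0]; exact mul_nonneg (by linarith [ht.2]) hx0
    have hps : ∀ t ∈ Set.Icc (0:ℝ) 1, p t i0 ≤ δ₁ + s := by
      intro t ht; rw [hp0]; nlinarith [ht.1]
    have hpl : ∀ u t, ‖p u - p t‖ ≤ x i0 * |u - t| := by
      intro u t
      have : p u - p t = EuclideanSpace.single i0 (-((u - t) * x i0)) := by
        ext j
        by_cases hj : j = i0
        · subst hj; simp [p]; ring
        · simp [p, hj]
      rw [this, EuclideanSpace.norm_single, norm_neg, norm_mul, Real.norm_eq_abs,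
        Real.norm_eq_abs, abs_of_nonneg hx0, mul_comm]
    have hz : p 1 i0 = 0 := by rw [hp0]; ring
    refine ⟨p 1, hz, fun t => emb n (p t) (f (p t)), ?_, ?_, ?_, ?_⟩
    · have : p 0 = x := by
        ext j
        by_cases hj : j = i0
        · subst hj; simp [p]
        · simp [p, hj]
      simp only [this]
    · have : f (p 1) = 0 := by
        rw [hf1 _ hz.ge (by rw [hz]; positivity), hz, max_eq_left (by linarith : 0 - δ₁ ≤ 0)]
        simp
      simp only [this]
    · intro t ht
      exact ⟨p t, hpn t ht, rfl⟩
    · intro u hu t ht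
      refine (emb_sub_norm _ _ _ _ _).trans ?_
      have hGt : ∀ t, G (p t) = G x := fun t => hGi _ _
      have e2 : |f (p u) - f (p t)| ≤ (x i0 + x i0) * |u - t| := by
        rw [hf1 _ (hpn u hu) (hps u hu), hf1 _ (hpn t ht) (hps t ht), hGt, hGt]
        refine prod_est hε hs.le (hd0 _) ((hd _ _).trans (hpl u t)) ?_ ?_ (hG x) hsε
          (by positivity)
        · rw [abs_of_nonneg (le_max_left _ _)]
          exact max_le hs.le (by linarith [hps u hu])
        · have := abs_max_sub_max_le_abs (p u i0 - δ₁) (p t i0 - δ₁) 0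
          rw [max_comm _ 0, max_comm _ 0] at this
          refine this.trans ?_
          rw [hp0, hp0, show (1 - u) * x i0 - δ₁ - ((1 - t) * x i0 - δ₁) = -((u - t) * x i0) by ring,
            abs_neg, abs_mul, abs_of_nonneg hx0, mul_comm]
      have e1 := hpl u t
      have : x i0 * |u - t| ≤ (2 * ε) * |u - t| := by gcongr; linarith
      have : 0 ≤ ε * |u - t| := by positivity
      linarith
  rcases le_total (x i0) (δ₁ + s) with h | h
  · obtain ⟨z, hz, hp⟩ := key1 x hx h
    exact ⟨z, hz, hp.mono (by linarith)⟩
  -- rotation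
  have hqi : q i0 = δ₁ + s := by simp [hq]
  set v := x - q with hv
  set a := v i0 with ha
  have ha0 : 0 ≤ a := by rw [ha, hv]; simp [hqi]; linarith
  set e : EuclideanSpace ℝ (Fin n) := EuclideanSpace.single i0 1 with he
  obtain ⟨u, b, hu, hu0, hb, hvu⟩ : ∃ (u : EuclideanSpace ℝ (Fin n)) (b : ℝ), ‖u‖ = 1 ∧ u i0 = 0 ∧
      0 ≤ b ∧ v = a • e + b • u := by
    by_cases hw : v - a • e = 0
    · refine ⟨EuclideanSpace.single i1 1, 0, by simp, by simp [hi.symm], le_rfl, ?_⟩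
      rw [sub_eq_zero] at hw
      simpa using hw
    · have hw' : ‖v - a • e‖ ≠ 0 := norm_ne_zero_iff.2 hw
      refine ⟨‖v - a • e‖⁻¹ • (v - a • e), ‖v - a • e‖, ?_, ?_, norm_nonneg _, ?_⟩
      · rw [norm_smul, norm_inv, norm_norm, inv_mul_cancel₀ hw']
      · simp [he, ha]
      · rw [smul_smul, mul_inv_cancel₀ hw']; simp
  have hN : ∀ α β : ℝ, ‖α • e + β • u‖ ^ 2 = α ^ 2 + β ^ 2 := by
    intro α β
    have hin : inner ℝ (α • e) (β • u) = 0 := by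
      rw [inner_smul_left, inner_smul_right, he, EuclideanSpace.inner_single_left]
      simp [hu0]
    rw [norm_add_sq_real, hin, norm_smul, norm_smul, hu, he]
    simp
  set r := ‖v‖ with hr
  have hr0 : 0 ≤ r := norm_nonneg _
  have hrab : r ^ 2 = a ^ 2 + b ^ 2 := by rw [hr, hvu, hN]
  obtain ⟨θ, hθ0, hθ1, hcos, hsin⟩ : ∃ θ : ℝ, 0 ≤ θ ∧ θ ≤ Real.pi / 2 ∧ r * Real.cos θ = a ∧
      r * Real.sin θ = b := by
    rcases hr0.eq_or_lt with h0 | h0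
    · refine ⟨0, le_rfl, by positivity, ?_, ?_⟩ <;> rw [← h0] at hrab ⊢ <;> nlinarith
    · refine ⟨Real.arccos (a / r), Real.arccos_nonneg _, Real.arccos_le_pi_div_two.2 (by positivity),
        ?_, ?_⟩
      · rw [Real.cos_arccos]
        · field_simp
        · have : 0 ≤ a / r := by positivity
          linarith
        · rw [div_le_one h0]; nlinarith
      · rw [Real.sin_arccos, show 1 - (a / r) ^ 2 = (b / r) ^ 2 by field_simp; linarith,
          Real.sqrt_sq (by positivity)]
        field_simp
  let φ : ℝ → ℝ := fun t => θ + t * (Real.pi / 2 - θ)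
  let p : ℝ → EuclideanSpace ℝ (Fin n) := fun t =>
    q + ((r * Real.cos (φ t)) • e + (r * Real.sin (φ t)) • u)
  have hφl : ∀ y t, |φ y - φ t| ≤ 2 * |y - t| := by
    intro y t
    rw [show φ y - φ t = (Real.pi / 2 - θ) * (y - t) by simp only [φ]; ring, abs_mul,
      abs_of_nonneg (by linarith)]
    gcongr
    linarith [Real.pi_le_four]
  have hp0 : ∀ t, p t i0 = δ₁ + s + r * Real.cos (φ t) := by
    intro t; simp [p, hqi, he, hu0]
  have hpn : ∀ t ∈ Set.Icc (0:ℝ) 1, δ₁ + s ≤ p t i0 := by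
    intro t ht
    rw [hp0]
    have : 0 ≤ Real.cos (φ t) := by
      apply Real.cos_nonneg_of_mem_Icc
      constructor
      · have := mul_nonneg ht.1 (by linarith : 0 ≤ Real.pi / 2 - θ)
        simp only [φ]; linarith [Real.pi_pos]
      · simp only [φ]
        nlinarith [mul_nonneg (sub_nonneg.2 ht.2) (by linarith : 0 ≤ Real.pi / 2 - θ)]
    have := mul_nonneg hr0 this
    linarith
  have hpq : ∀ t, ‖p t - q‖ = r := by
    intro t
    have : ‖p t - q‖ ^ 2 = r ^ 2 := by
      simp only [p, add_sub_cancel_left]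
      rw [hN]
      nlinarith [Real.sin_sq_add_cos_sq (φ t)]
    exact (sq_eq_sq₀ (norm_nonneg _) hr0).1 this
  have hen : ‖e‖ = 1 := by simp [he]
  have hpl : ∀ y t, ‖p y - p t‖ ≤ 20 * ε * |y - t| := by
    intro y t
    have : p y - p t = (r * (Real.cos (φ y) - Real.cos (φ t))) • e
        + (r * (Real.sin (φ y) - Real.sin (φ t))) • u := by
      simp only [p]; module
    rw [this]
    refine (norm_add_le _ _).trans ?_
    rw [norm_smul, norm_smul, hen, hu, norm_mul, norm_mul, Real.norm_of_nonneg hr0, mul_one, mul_one,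
      Real.norm_eq_abs, Real.norm_eq_abs]
    have c1 := (Real.abs_cos_sub_cos_le (φ y) (φ t)).trans (hφl y t)
    have c2 := (Real.abs_sin_sub_sin_le (φ y) (φ t)).trans (hφl y t)
    calc _ ≤ 5 * ε * (2 * |y - t|) + 5 * ε * (2 * |y - t|) := by gcongr
      _ = _ := by ring
  have hp1 : p 0 = x := by
    simp only [p, φ, zero_mul, add_zero, hcos, hsin, ← hvu]
    rw [hv]; abel
  have hp2 : p 1 i0 = δ₁ + s := by
    rw [hp0]; simp [φ]
  obtain ⟨z, hz, hpath⟩ := key1 (p 1) (by rw [hp2]; positivity) hp2.le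
  refine ⟨z, hz, ?_⟩
  have : 160 * ε = 4 * (40 * ε) := by ring
  rw [this]
  refine LPath.trans (by positivity) ?_ hpath
  refine ⟨fun t => emb n (p t) (f (p t)), ?_, rfl, ?_, ?_⟩
  · simp only [hp1]
  · intro t ht
    exact ⟨p t, by have := hpn t ht; linarith, rfl⟩
  · intro y hy t ht
    refine (emb_sub_norm _ _ _ _ _).trans ?_
    have e2 : |f (p y) - f (p t)| ≤ (20 * ε + 0) * |y - t| := by
      rw [hf2 _ (hpn y hy), hf2 _ (hpn t ht), hpq, hpq]
      refine prod_est hε hs.le (hd0 _) ((hd _ _).trans (hpl y t)) ?_ ?_ (hH r) hsε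
        (by positivity)
      · rw [abs_of_pos hs]
      · simp
    have e1 := hpl y t
    linarith

lemma F_bound {F : ℝ → ℝ} (hFper : ∀ t, F (t + 4) = F t)
    (hF1 : ∀ t ∈ Set.Icc (0 : ℝ) 2, F t = 1 - t)
    (hF2 : ∀ t ∈ Set.Icc (2 : ℝ) 4, F t = t - 3) (t : ℝ) : |F t| ≤ 1 := by
  have hp : Function.Periodic F 4 := hFper
  obtain ⟨y, hy, h⟩ := hp.exists_mem_Ico₀ (by norm_num) t
  rw [h, abs_le]
  rcases le_total y 2 with h2 | h2
  · rw [hF1 y ⟨hy.1, h2⟩]; constructor <;> linarith [hy.1]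
  · rw [hF2 y ⟨h2, hy.2.le⟩]; constructor <;> linarith [hy.2]

lemma norm_split (m : ℕ) (v : EuclideanSpace ℝ (Fin (m + 1))) (w : EuclideanSpace ℝ (Fin m))
    (h : ∀ i : Fin m, w i = v i.succ) : ‖v‖ ≤ |v 0| + ‖w‖ := by
  have h : ‖v‖ ^ 2 = |v 0| ^ 2 + ‖w‖ ^ 2 := by
    rw [EuclideanSpace.norm_sq_eq, EuclideanSpace.norm_sq_eq, Fin.sum_univ_succ]
    simp [h]
  refine abs_le_of_sq_le_sq' (a := ‖v‖) ?_ (by positivity) |>.2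
  rw [h]
  nlinarith [mul_nonneg (norm_nonneg w) (abs_nonneg (v 0))]

/-- With the parameters `δ₁ = ε³`, `δ₂ = ε^{3/2}`, `ω = ε⁻³`, `ρ = ε` and
the deformation function `f` supported in `Ω ∪ D`, there are constants `K, ε₀ > 0` such
that for every `0 < ε < ε₀` and every `x ∈ Ω ∪ D` there is a rectifiable path in the graph
`S_f = {(y, f(y)) : y₁ ≥ 0} ⊆ ℝ^{n+1}` from `(x, f(x))` to a point `(z, 0)` with `z₁ = 0`,
of (Euclidean) length at most `K ε`. -/
theorem stmt_10 (n : ℕ) (hn : 2 ≤ n)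
    (F : ℝ → ℝ) (hFper : ∀ t, F (t + 4) = F t)
    (hF1 : ∀ t ∈ Set.Icc (0 : ℝ) 2, F t = 1 - t)
    (hF2 : ∀ t ∈ Set.Icc (2 : ℝ) 4, F t = t - 3) :
    ∃ K > (0 : ℝ), ∃ ε₀ > (0 : ℝ), ∀ ε : ℝ, 0 < ε → ε < ε₀ →
      ∀ (q : EuclideanSpace ℝ (Fin n))
        (pr : EuclideanSpace ℝ (Fin n) → EuclideanSpace ℝ (Fin (n - 1)))
        (A B C Ω D : Set (EuclideanSpace ℝ (Fin n)))
        (f : EuclideanSpace ℝ (Fin n) → ℝ),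
        q = EuclideanSpace.single (⟨0, by omega⟩ : Fin n) (ε ^ 3 + ε ^ ((3 : ℝ) / 2)) →
        (∀ x i, pr x i = x ⟨i.1 + 1, by have := i.2; omega⟩) →
        A = {x | ε ^ 3 + ε ^ ((3 : ℝ) / 2) ≤ x ⟨0, by omega⟩ ∧ ‖x - q‖ ≤ ε} →
        B = {x | ε ^ 3 ≤ x ⟨0, by omega⟩ ∧
              x ⟨0, by omega⟩ ≤ ε ^ 3 + ε ^ ((3 : ℝ) / 2) ∧ ‖pr x‖ ≤ ε} →
        C = {x | 0 ≤ x ⟨0, by omega⟩ ∧ x ⟨0, by omega⟩ ≤ ε ^ 3 ∧ ‖pr x‖ ≤ ε} →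
        Ω = A ∪ B ∪ C →
        D = {x | x ∉ Ω ∧ 0 ≤ x ⟨0, by omega⟩ ∧ Metric.infDist x Ω ≤ ε} →
        (∀ x : EuclideanSpace ℝ (Fin n), 0 ≤ x ⟨0, by omega⟩ →
          x ⟨0, by omega⟩ ≤ ε ^ 3 + ε ^ ((3 : ℝ) / 2) →
          f x = max 0 (1 - Metric.infDist x Ω / ε) *
            (max 0 (x ⟨0, by omega⟩ - ε ^ 3) * F ((ε ^ 3)⁻¹ * ‖pr x‖))) →
        (∀ x : EuclideanSpace ℝ (Fin n), ε ^ 3 + ε ^ ((3 : ℝ) / 2) ≤ x ⟨0, by omega⟩ →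
          f x = max 0 (1 - Metric.infDist x Ω / ε) *
            (ε ^ ((3 : ℝ) / 2) * F ((ε ^ 3)⁻¹ * ‖x - q‖))) →
        ∀ x ∈ Ω ∪ D, ∃ γ : ℝ → EuclideanSpace ℝ (Fin (n + 1)),
          ContinuousOn γ (Set.Icc 0 1) ∧
          γ 0 = emb n x (f x) ∧
          (∃ z : EuclideanSpace ℝ (Fin n), z ⟨0, by omega⟩ = 0 ∧ γ 1 = emb n z 0) ∧
          (∀ t ∈ Set.Icc (0 : ℝ) 1, ∃ y : EuclideanSpace ℝ (Fin n),
            0 ≤ y ⟨0, by omega⟩ ∧ γ t = emb n y (f y)) ∧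
          eVariationOn γ (Set.Icc 0 1) ≤ ENNReal.ofReal (K * ε) := by
  refine ⟨160, by norm_num, 1, one_pos, ?_⟩
  intro ε hε hε1 q pr A B C Ω D f hq hpr hA hB hC hΩ hD hf1 hf2 x hx
  obtain ⟨m, rfl⟩ : ∃ m, n = m + 2 := ⟨n - 2, by omega⟩
  have hs : 0 < ε ^ ((3 : ℝ) / 2) := by positivity
  have hsε : ε ^ ((3 : ℝ) / 2) ≤ ε := by
    have := Real.rpow_le_rpow_of_exponent_ge hε hε1.le (by norm_num : (1 : ℝ) ≤ 3 / 2)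
    simpa using this
  have hδ : 0 < ε ^ 3 := by positivity
  have hδε : ε ^ 3 ≤ ε := pow_le_of_le_one hε.le hε1.le (by norm_num)
  generalize ε ^ ((3 : ℝ) / 2) = s at *
  have hFb := F_bound hFper hF1 hF2
  have hpr0 : pr 0 = 0 := by ext i; rw [hpr]; simp
  have hne : Ω.Nonempty := by
    refine ⟨0, ?_⟩
    rw [hΩ, hC]
    right
    refine ⟨by simp, by simpa using hδ.le, by rw [hpr0]; simpa using hε.le⟩
  have hpos : ∀ y ∈ Ω, 0 ≤ y ⟨0, by omega⟩ := by
    intro y hy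
    rw [hΩ, hA, hB, hC] at hy
    rcases hy with (hy | hy) | hy
    · have := hy.1; linarith
    · have := hy.1; linarith
    · exact hy.1
  have hqi : q ⟨0, by omega⟩ = ε ^ 3 + s := by rw [hq]; simp
  have hbd : ∀ y ∈ Ω, ‖y - q‖ ≤ 3 * ε := by
    intro y hy
    have hsplit := norm_split (m + 1) (y - q) (pr y) (by
      intro i
      rw [hpr, hq]
      simp
      rfl)
    have h0 : (y - q) 0 = y ⟨0, by omega⟩ - (ε ^ 3 + s) := by
      rw [← hqi]; rfl
    rw [h0] at hsplit
    rw [hΩ, hA, hB, hC] at hy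
    rcases hy with (hy | hy) | hy
    · have := hy.2; linarith
    · obtain ⟨h1, h2, h3⟩ := hy
      rw [abs_of_nonpos (by linarith)] at hsplit
      linarith
    · obtain ⟨h1, h2, h3⟩ := hy
      rw [abs_of_nonpos (by linarith)] at hsplit
      linarith
  have hx0 : 0 ≤ x ⟨0, by omega⟩ := by
    rcases hx with hx | hx
    · exact hpos x hx
    · rw [hD] at hx; exact hx.2.1
  have hxq : ‖x - q‖ ≤ 5 * ε := by
    rcases hx with hx | hx
    · have := hbd x hx; linarith
    · rw [hD] at hx
      have h2 : Metric.infDist x Ω < 2 * ε := by have := hx.2.2; linarith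
      obtain ⟨y, hy, hxy⟩ := (Metric.infDist_lt_iff hne).1 h2
      have := hbd y hy
      rw [dist_eq_norm] at hxy
      have h3 := norm_sub_le_norm_sub_add_norm_sub x y q
      linarith
  obtain ⟨z, hz, hp⟩ := core (i0 := (⟨0, by omega⟩ : Fin (m + 2))) (i1 := ⟨1, by omega⟩)
    (by simp) hε hs hsε hδ hδε hq
    (d := fun x => Metric.infDist x Ω) (G := fun x => F ((ε ^ 3)⁻¹ * ‖pr x‖)) (f := f)
    (H := fun t => F ((ε ^ 3)⁻¹ * t)) (fun _ => Metric.infDist_nonneg)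
    (fun x y => by
      rw [abs_le, ← dist_eq_norm]
      have h1 := Metric.infDist_le_infDist_add_dist (s := Ω) (x := x) (y := y)
      have h2 := Metric.infDist_le_infDist_add_dist (s := Ω) (x := y) (y := x)
      rw [dist_comm y x] at h2
      constructor <;> linarith)
    (fun _ => hFb _)
    (fun x c => by
      have : pr (x + EuclideanSpace.single (⟨0, by omega⟩ : Fin (m + 2)) c) = pr x := by
        ext i
        rw [hpr, hpr]
        simp
      simp only [this])
    (fun _ => hFb _) hf1 hf2 x hx0 hxq
  obtain ⟨g, g1, g2, g3, g4, g5⟩ := hp.fin (by positivity)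
  exact ⟨g, g1, g2, ⟨z, hz, g3⟩, g4, g5⟩
end
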